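/- arXiv:1203.6791 — 2 statements merged into one kernel-verified Lean document; each statement's English description precedes it below -/
import Mathlib

section
/- Suppose X has information dimension d(X) > 0, the conditional information dimensions d(X|Y=y) exist for P_Y-almost every y, and all relevant limits exist with the conditional entropies H(X̂_n|Y=y)/log n dominated by an integrable function. Then the relative information loss satisfies l(X→Y) = E_Y[d(X|Y=y)] / d(X). -/
open Filter MeasureTheory

/-- (Theorem: relative information loss via information dimension.)
Let `PY` be the distribution of `Y`, `H n = H(X̂_n)` the entropies of the quantizations
`X̂_n = ⌊nX⌋/n`, and `Hc n y = H(X̂_n | Y = y)` the conditional entropies.  Suppose the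
information dimension `dX = d(X) = lim_n H(X̂_n)/log n` exists with `dX > 0`, the
conditional information dimensions `d y = d(X|Y=y) = lim_n H(X̂_n|Y=y)/log n` exist for
`PY`-a.e. `y`, the family `y ↦ H(X̂_n|Y=y)/log n` is dominated by a `PY`-integrable
function `g`, and the relative information loss
`l = lim_n H(X̂_n|Y)/H(X̂_n)` (with `H(X̂_n|Y) = ∫ H(X̂_n|Y=y) dPY(y)`) exists.
Then `l = E_Y[d(X|Y=y)] / d(X)`. -/
theorem rel_loss_eq_ratio_of_information_dimensions
    {β : Type*} [MeasurableSpace β]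
    (PY : Measure β) [IsProbabilityMeasure PY]
    (H : ℕ → ℝ) (Hc : ℕ → β → ℝ)
    (hHc_meas : ∀ n, Measurable (Hc n))
    (d : β → ℝ) (dX l : ℝ)
    (hdX : Tendsto (fun n => H n / Real.log n) atTop (nhds dX))
    (hdX_pos : 0 < dX)
    (hd : ∀ᵐ y ∂PY, Tendsto (fun n => Hc n y / Real.log n) atTop (nhds (d y)))
    (g : β → ℝ) (hg : Integrable g PY)
    (hdom : ∀ n, 2 ≤ n → ∀ᵐ y ∂PY, |Hc n y / Real.log n| ≤ g y)
    (hl : Tendsto (fun n => (∫ y, Hc n y ∂PY) / H n) atTop (nhds l)) :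
    l = (∫ y, d y ∂PY) / dX := by
  have hint : Tendsto (fun n : ℕ => ∫ y, Hc n y / Real.log n ∂PY) atTop (nhds (∫ y, d y ∂PY)) := by
    refine tendsto_integral_filter_of_dominated_convergence g ?_ ?_ hg hd
    · exact Eventually.of_forall fun n => ((hHc_meas n).div_const _).aestronglyMeasurable
    · filter_upwards [eventually_ge_atTop 2] with n hn
      exact hdom n hn
  refine tendsto_nhds_unique hl ((hint.div hdX hdX_pos.ne').congr' ?_)
  filter_upwards [eventually_ge_atTop 2] with n hn
  have hlog : Real.log n ≠ 0 := (Real.log_pos (by exact_mod_cast hn)).ne'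
  simp only [Pi.div_apply, integral_div]
  exact div_div_div_cancel_right₀ hlog _ _
end

section
/- Let X be an N-dimensional random variable whose distribution is absolutely continuous with respect to N-dimensional Lebesgue measure, with H(X̂_1) < ∞ and existing finite differential entropy h(X). Then H(X̂_n) = N log n + h(X) + o(1) as n → ∞; in particular the information dimension d(X) = lim_{n→∞} H(X̂_n)/log n equals N. -/
open Filter MeasureTheory ENNReal

/-- The Shannon entropy `H(X̂_n)` of the quantization `X̂_n = ⌊nX⌋/n` of a random
vector with distribution `ν` on `ℝᴺ`: the quantization cell of index `k ∈ ℤᴺ` is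
`{x | ∀ i, ⌊n xᵢ⌋ = kᵢ}` (a hypercube of side `1/n`). -/
noncomputable def quantEntropy {N : ℕ} (ν : Measure (Fin N → ℝ)) (n : ℕ) : ℝ :=
  ∑' k : Fin N → ℤ, Real.negMulLog (ν {x | ∀ i, ⌊(n : ℝ) * x i⌋ = k i}).toReal

/-- The index `⌊n x⌋ ∈ ℤᴺ` of the quantization cell of side `1/n` containing `x`. -/
noncomputable def quantIndex {N : ℕ} (n : ℕ) (x : Fin N → ℝ) : Fin N → ℤ :=
  fun i => ⌊(n : ℝ) * x i⌋

/-- The density obtained by averaging the measure `ν` over the quantization cells of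
side `1/n`. -/
noncomputable def cellDensity {N : ℕ} (ν : Measure (Fin N → ℝ)) (n : ℕ) (x : Fin N → ℝ) : ℝ≥0∞ :=
  (n : ℝ≥0∞) ^ N * ν (quantIndex n ⁻¹' {quantIndex n x})

theorem mul_log_le_mul_log_sub_add {s t : ℝ} (hs : 0 ≤ s) (ht : 0 ≤ t) (hst : t = 0 → s = 0) :
    s * Real.log t ≤ s * Real.log s - s + t := by
  rcases hs.eq_or_lt with rfl | hs
  · simpa using ht
  have ht : 0 < t := ht.lt_of_ne fun h => hs.ne' (hst h.symm)
  have h := Real.log_le_sub_one_of_pos (div_pos ht hs)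
  rw [Real.log_div ht.ne' hs.ne'] at h
  have := mul_le_mul_of_nonneg_left h hs.le
  have h2 : s * (t / s - 1) = t - s := by field_simp
  linarith

section Cells

variable {N : ℕ}

theorem measurable_quantIndex (n : ℕ) : Measurable (quantIndex n : (Fin N → ℝ) → Fin N → ℤ) :=
  measurable_pi_lambda _ fun i => (((measurable_pi_apply i).const_mul _).floor)

theorem measurableSet_cell (n : ℕ) (k : Fin N → ℤ) :
    MeasurableSet (quantIndex n ⁻¹' {k} : Set (Fin N → ℝ)) :=
  measurable_quantIndex n (MeasurableSet.singleton k)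

theorem setOf_floor_eq (n : ℕ) (k : Fin N → ℤ) :
    {x : Fin N → ℝ | ∀ i, ⌊(n : ℝ) * x i⌋ = k i} = quantIndex n ⁻¹' {k} := by
  ext x
  simp [quantIndex, funext_iff]

theorem cell_eq_pi_Ico {n : ℕ} (hn : 0 < n) (k : Fin N → ℤ) :
    (quantIndex n ⁻¹' {k} : Set (Fin N → ℝ)) =
      Set.pi Set.univ fun i => Set.Ico ((k i : ℝ) / n) ((k i + 1) / n) := by
  ext x
  have hn' : (0 : ℝ) < n := by exact_mod_cast hn
  simp [quantIndex, funext_iff, Int.floor_eq_iff, div_le_iff₀ hn', lt_div_iff₀ hn', mul_comm]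

theorem pow_mul_volume_cell {n : ℕ} (hn : 0 < n) (k : Fin N → ℤ) :
    (n : ℝ≥0∞) ^ N * volume (quantIndex n ⁻¹' {k} : Set (Fin N → ℝ)) = 1 := by
  have hn' : (0 : ℝ) < n := by exact_mod_cast hn
  have h : ∀ i, ((k i : ℝ) + 1) / n - k i / n = (n : ℝ)⁻¹ := fun i => by field_simp; ring
  rw [cell_eq_pi_Ico hn, Real.volume_pi_Ico]
  simp only [h, Finset.prod_const, Finset.card_univ, Fintype.card_fin]
  rw [← mul_pow, ENNReal.ofReal_inv_of_pos hn', ENNReal.ofReal_natCast,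
    ENNReal.mul_inv_cancel (by exact_mod_cast hn.ne') (ENNReal.natCast_ne_top n), one_pow]

theorem quantIndex_one {n : ℕ} (hn : 0 < n) (x : Fin N → ℝ) :
    quantIndex 1 x = fun i => quantIndex n x i / (n : ℤ) := by
  have hn' : (n : ℝ) ≠ 0 := by exact_mod_cast hn.ne'
  funext i
  simp only [quantIndex, Nat.cast_one, one_mul]
  rw [← Int.floor_div_natCast, mul_div_cancel_left₀ _ hn']

theorem closedBall_ae_eq_cell {n : ℕ} (hn : 0 < n) (k : Fin N → ℤ) :
    (Metric.closedBall (fun i => ((k i : ℝ) + 2⁻¹) / n) (2⁻¹ / n) : Set (Fin N → ℝ))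
      =ᵐ[volume] quantIndex n ⁻¹' {k} := by
  have hn' : (0 : ℝ) < n := by exact_mod_cast hn
  rw [cell_eq_pi_Ico hn, closedBall_pi _ (by positivity)]
  have : (fun i => Metric.closedBall (((k i : ℝ) + 2⁻¹) / n) (2⁻¹ / n)) =
      fun i => Set.Icc ((k i : ℝ) / n) ((k i + 1) / n) := by
    funext i
    rw [Real.closedBall_eq_Icc]
    congr 1 <;> field_simp <;> ring
  rw [this, Set.pi_univ_Icc]
  exact Measure.univ_pi_Ico_ae_eq_Icc.symm

theorem mem_closedBall_quantIndex {n : ℕ} (hn : 0 < n) (x : Fin N → ℝ) :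
    x ∈ Metric.closedBall (fun i => ((quantIndex n x i : ℝ) + 2⁻¹) / n) (2⁻¹ / n) := by
  have hn' : (0 : ℝ) < n := by exact_mod_cast hn
  rw [closedBall_pi _ (by positivity)]
  intro i _
  simp only [Real.closedBall_eq_Icc]
  have h1 := Int.floor_le ((n : ℝ) * x i)
  have h2 := Int.lt_floor_add_one ((n : ℝ) * x i)
  simp only [quantIndex]
  constructor
  · rw [← sub_div, div_le_iff₀ hn']
    linarith
  · rw [← add_div, le_div_iff₀ hn']
    linarith

end Cells

section CellDensity

variable {N : ℕ} (ν : Measure (Fin N → ℝ)) (n : ℕ)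

theorem measurable_cellDensity : Measurable (cellDensity ν n) :=
  (Measurable.of_discrete
    (f := fun k : Fin N → ℤ => (n : ℝ≥0∞) ^ N * ν (quantIndex n ⁻¹' {k}))).comp
      (measurable_quantIndex n)

theorem cellDensity_toReal (x : Fin N → ℝ) :
    (cellDensity ν n x).toReal = (n : ℝ) ^ N * ν.real (quantIndex n ⁻¹' {quantIndex n x}) := by
  simp [cellDensity, Measure.real]

theorem cellDensity_lt_top [IsFiniteMeasure ν] (x : Fin N → ℝ) : cellDensity ν n x < ∞ :=
  ENNReal.mul_lt_top (ENNReal.pow_lt_top (ENNReal.natCast_lt_top n)) (measure_lt_top _ _)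

variable {n}

theorem ae_cellDensity_toReal_pos [IsFiniteMeasure ν] (hn : 0 < n) :
    ∀ᵐ x ∂ν, 0 < (cellDensity ν n x).toReal := by
  have h : ∀ᵐ k ∂(ν.map (quantIndex n)), 0 < ν.real (quantIndex n ⁻¹' {k}) := by
    rw [ae_iff_of_countable]
    intro k hk
    rw [Measure.map_apply (measurable_quantIndex n) (MeasurableSet.singleton k)] at hk
    exact ENNReal.toReal_pos hk (measure_ne_top _ _)
  filter_upwards [ae_of_ae_map (measurable_quantIndex n).aemeasurable h] with x hx
  rw [cellDensity_toReal]
  positivity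

theorem cellDensity_toReal_eq_zero_of_one [IsFiniteMeasure ν] (hn : 0 < n) (x : Fin N → ℝ)
    (h : (cellDensity ν 1 x).toReal = 0) : (cellDensity ν n x).toReal = 0 := by
  rw [cellDensity_toReal] at h ⊢
  simp only [Nat.cast_one, one_pow, one_mul] at h
  have : ν.real (quantIndex n ⁻¹' {quantIndex n x}) = 0 := by
    refine le_antisymm (h ▸ measureReal_mono fun y hy => ?_) measureReal_nonneg
    rw [Set.mem_preimage, Set.mem_singleton_iff] at hy ⊢
    rw [quantIndex_one hn, quantIndex_one hn, hy]
  rw [this, mul_zero]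

theorem map_withDensity_cellDensity (hn : 0 < n) :
    (volume.withDensity (cellDensity ν n)).map (quantIndex n) = ν.map (quantIndex n) := by
  refine Measure.ext_of_singleton fun k => ?_
  have hk := measurableSet_cell n k
  rw [Measure.map_apply (measurable_quantIndex n) (MeasurableSet.singleton k),
    Measure.map_apply (measurable_quantIndex n) (MeasurableSet.singleton k),
    withDensity_apply _ hk, setLIntegral_congr_fun (g := fun _ => (n : ℝ≥0∞) ^ N *
      ν (quantIndex n ⁻¹' {k})) hk, setLIntegral_const, mul_right_comm, pow_mul_volume_cell hn,
    one_mul]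
  intro x hx
  rw [Set.mem_preimage, Set.mem_singleton_iff] at hx
  simp only [cellDensity, hx]

theorem integrable_comp_quantIndex_iff [IsFiniteMeasure ν] (hn : 0 < n) (g : (Fin N → ℤ) → ℝ) :
    Integrable (fun x => g (quantIndex n x)) ν ↔
      Integrable (fun x => (cellDensity ν n x).toReal * g (quantIndex n x)) volume := by
  have hg (μ : Measure (Fin N → ℤ)) : AEStronglyMeasurable g μ :=
    Measurable.of_discrete.aestronglyMeasurable
  have hκ := (measurable_quantIndex (N := N) n).aemeasurable (μ := ν)
  have hκ' := (measurable_quantIndex (N := N) n).aemeasurable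
    (μ := volume.withDensity (cellDensity ν n))
  have h1 := integrable_map_measure (hg _) hκ
  have h2 := integrable_map_measure (hg _) hκ'
  rw [map_withDensity_cellDensity ν hn] at h2
  have h3 := integrable_withDensity_iff_integrable_smul' (measurable_cellDensity ν n)
    (ae_of_all volume (cellDensity_lt_top ν n)) (g := g ∘ quantIndex n)
  exact h1.symm.trans (h2.trans h3)

theorem integral_comp_quantIndex [IsFiniteMeasure ν] (hn : 0 < n) (g : (Fin N → ℤ) → ℝ) :
    ∫ x, g (quantIndex n x) ∂ν = ∫ x, (cellDensity ν n x).toReal * g (quantIndex n x) := by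
  have hg (μ : Measure (Fin N → ℤ)) : AEStronglyMeasurable g μ :=
    Measurable.of_discrete.aestronglyMeasurable
  have hκ := (measurable_quantIndex (N := N) n).aemeasurable (μ := ν)
  have hκ' := (measurable_quantIndex (N := N) n).aemeasurable
    (μ := volume.withDensity (cellDensity ν n))
  have h1 := integral_map hκ (hg _)
  have h2 := integral_map hκ' (hg _)
  rw [map_withDensity_cellDensity ν hn] at h2
  have h3 := integral_withDensity_eq_integral_toReal_smul (measurable_cellDensity ν n)
    (ae_of_all volume (cellDensity_lt_top ν n)) (fun x => g (quantIndex n x))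
  exact h1.symm.trans (h2.trans h3)

theorem integrable_cellDensity [IsFiniteMeasure ν] (hn : 0 < n) :
    Integrable (fun x => (cellDensity ν n x).toReal) volume := by
  simpa using (integrable_comp_quantIndex_iff ν hn fun _ => 1).1 (integrable_const 1)

theorem integral_cellDensity [IsProbabilityMeasure ν] (hn : 0 < n) :
    ∫ x, (cellDensity ν n x).toReal = 1 := by
  simpa using (integral_comp_quantIndex ν hn fun _ => 1).symm

theorem log_cellDensity_eq_comp (n : ℕ) (x : Fin N → ℝ) :
    Real.log (cellDensity ν n x).toReal =
      (fun k => Real.log ((n : ℝ) ^ N * ν.real (quantIndex n ⁻¹' {k}))) (quantIndex n x) := by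
  rw [cellDensity_toReal]

theorem cellDensity_one_eq_comp (hn : 0 < n) (x : Fin N → ℝ) :
    (cellDensity ν 1 x).toReal =
      (fun k : Fin N → ℤ => ν.real (quantIndex 1 ⁻¹' {fun i => k i / (n : ℤ)}))
        (quantIndex n x) := by
  rw [cellDensity_toReal, quantIndex_one hn]
  simp

theorem integrable_log_cellDensity_one [IsFiniteMeasure ν]
    (h : Summable fun k : Fin N → ℤ =>
      Real.negMulLog (ν {x | ∀ i, ⌊(1 : ℝ) * x i⌋ = k i}).toReal) :
    Integrable (fun x => Real.log (cellDensity ν 1 x).toReal) ν := by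
  simp_rw [log_cellDensity_eq_comp]
  refine (integrable_map_measure (g := fun k : Fin N → ℤ =>
      Real.log (((1 : ℕ) : ℝ) ^ N * ν.real (quantIndex 1 ⁻¹' {k})))
    Measurable.of_discrete.aestronglyMeasurable (measurable_quantIndex 1).aemeasurable).1 ?_
  rw [← Measure.sum_smul_dirac (ν.map (quantIndex 1)),
    integrable_sum_dirac_iff fun i => measure_ne_top _ _]
  refine h.norm.congr fun k => ?_
  have h1 := setOf_floor_eq 1 k
  rw [Nat.cast_one] at h1
  rw [h1, Measure.map_apply (measurable_quantIndex 1) (MeasurableSet.singleton k)]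
  simp [Real.negMulLog, Measure.real]

theorem integrable_log_cellDensity [IsProbabilityMeasure ν] (hn : 0 < n)
    (h : Integrable (fun x => Real.log (cellDensity ν 1 x).toReal) ν) :
    Integrable (fun x => Real.log (cellDensity ν n x).toReal) ν := by
  have hratio : Integrable
      (fun x => (cellDensity ν 1 x).toReal / (cellDensity ν n x).toReal) ν := by
    simp_rw [cellDensity_one_eq_comp ν hn, cellDensity_toReal ν n]
    refine (integrable_comp_quantIndex_iff ν hn fun k =>
      ν.real (quantIndex 1 ⁻¹' {fun i => k i / (n : ℤ)}) /
        ((n : ℝ) ^ N * ν.real (quantIndex n ⁻¹' {k}))).2 ?_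
    refine (integrable_cellDensity ν one_pos).mono ?_ (ae_of_all _ fun x => ?_)
    · exact ((measurable_cellDensity ν n).ennreal_toReal.mul
        ((Measurable.of_discrete (f := fun k => ν.real (quantIndex 1 ⁻¹' {fun i => k i / (n : ℤ)}) /
          ((n : ℝ) ^ N * ν.real (quantIndex n ⁻¹' {k})))).comp
            (measurable_quantIndex n))).aestronglyMeasurable
    · rw [cellDensity_one_eq_comp ν hn, ← cellDensity_toReal ν n]
      by_cases h0 : (cellDensity ν n x).toReal = 0
      · simp [h0]
      · rw [mul_div_cancel₀ _ h0]
  have hbound : Integrable (fun x => |Real.log ((n : ℝ) ^ N)| +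
      (|Real.log (cellDensity ν 1 x).toReal| +
        (cellDensity ν 1 x).toReal / (cellDensity ν n x).toReal)) ν :=
    (integrable_const _).add (h.abs.add hratio)
  refine hbound.mono' (measurable_cellDensity ν n).ennreal_toReal.log.aestronglyMeasurable ?_
  filter_upwards [ae_cellDensity_toReal_pos ν hn, ae_cellDensity_toReal_pos ν one_pos]
    with x hx hx1
  rw [Real.norm_eq_abs, abs_le]
  have hr : 0 < (cellDensity ν 1 x).toReal / (cellDensity ν n x).toReal := div_pos hx1 hx
  constructor
  · have h1 := Real.log_le_sub_one_of_pos hr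
    rw [Real.log_div hx1.ne' hx.ne'] at h1
    have h2 := neg_abs_le (Real.log (cellDensity ν 1 x).toReal)
    have h3 := abs_nonneg (Real.log ((n : ℝ) ^ N))
    linarith
  · have hle : (cellDensity ν n x).toReal ≤ (n : ℝ) ^ N := by
      rw [cellDensity_toReal]
      exact mul_le_of_le_one_right (by positivity) measureReal_le_one
    have h1 := (Real.log_le_log hx hle).trans (le_abs_self _)
    have h2 := abs_nonneg (Real.log (cellDensity ν 1 x).toReal)
    linarith

theorem quantEntropy_sub_eq [IsProbabilityMeasure ν] (hn : 0 < n)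
    (h : Integrable (fun x => Real.log (cellDensity ν n x).toReal) ν) :
    quantEntropy ν n - (N : ℝ) * Real.log n =
      -∫ x, Real.log (cellDensity ν n x).toReal ∂ν := by
  have hn' : (0 : ℝ) < n := by exact_mod_cast hn
  have key : ∫ x, ((N : ℝ) * Real.log n - Real.log (cellDensity ν n x).toReal) ∂ν =
      quantEntropy ν n := by
    have hae : (fun x => (N : ℝ) * Real.log n - Real.log (cellDensity ν n x).toReal) =ᵐ[ν]
        fun x => (fun k => -Real.log (ν.real (quantIndex n ⁻¹' {k}))) (quantIndex n x) := by
      filter_upwards [ae_cellDensity_toReal_pos ν hn] with x hx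
      rw [cellDensity_toReal] at hx ⊢
      rw [Real.log_mul (by positivity) (pos_of_mul_pos_right hx (by positivity)).ne',
        Real.log_pow]
      ring
    have hint := ((integrable_const ((N : ℝ) * Real.log n)).sub h).congr hae
    rw [integral_congr_ae hae]
    have hg : AEStronglyMeasurable (fun k => -Real.log (ν.real (quantIndex n ⁻¹' {k})))
      (ν.map (quantIndex n)) := Measurable.of_discrete.aestronglyMeasurable
    have hκ := (measurable_quantIndex (N := N) n).aemeasurable (μ := ν)
    rw [← integral_map hκ hg, integral_countable ((integrable_map_measure hg hκ).2 hint)]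
    refine tsum_congr fun k => ?_
    rw [setOf_floor_eq, map_measureReal_apply (measurable_quantIndex n)
      (MeasurableSet.singleton k)]
    simp [Real.negMulLog, Measure.real]
  rw [← key, integral_sub (integrable_const _) h]
  simp

theorem ae_tendsto_cellDensity [IsProbabilityMeasure ν] {f : (Fin N → ℝ) → ℝ≥0∞}
    (hf : Measurable f) (hac : ν = volume.withDensity f) :
    ∀ᵐ x, Tendsto (fun n => (cellDensity ν n x).toReal) atTop (nhds (f x).toReal) := by
  have hfin : ∫⁻ x, f x ≠ ∞ := by
    rw [← setLIntegral_univ, ← withDensity_apply _ MeasurableSet.univ, ← hac]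
    exact measure_ne_top _ _
  have hF : Integrable (fun x => (f x).toReal) volume :=
    integrable_toReal_of_lintegral_ne_top hf.aemeasurable hfin
  have hlt : ∀ᵐ x, f x < ∞ := ae_lt_top hf hfin
  filter_upwards [IsUnifLocDoublingMeasure.ae_tendsto_average volume hF.locallyIntegrable 1]
    with x hx
  have hδ : Tendsto (fun n : ℕ => (2⁻¹ : ℝ) / n) atTop (nhdsWithin 0 (Set.Ioi 0)) := by
    refine tendsto_nhdsWithin_iff.2 ⟨tendsto_const_div_atTop_nhds_zero_nat _, ?_⟩
    filter_upwards [eventually_gt_atTop 0] with n hn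
    have hn' : (0 : ℝ) < n := by exact_mod_cast hn
    exact div_pos (by norm_num) hn'
  refine (hx (fun n : ℕ => fun i => ((quantIndex n x i : ℝ) + 2⁻¹) / n) _ hδ ?_).congr' ?_
  · filter_upwards [eventually_gt_atTop 0] with n hn
    rw [one_mul]
    exact mem_closedBall_quantIndex hn x
  · filter_upwards [eventually_gt_atTop 0] with n hn
    have hae := closedBall_ae_eq_cell hn (quantIndex n x)
    have hvol := congrArg ENNReal.toReal (pow_mul_volume_cell hn (quantIndex n x))
    rw [ENNReal.toReal_mul, ENNReal.toReal_pow, ENNReal.toReal_natCast, ENNReal.toReal_one]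
      at hvol
    rw [setAverage_eq, measureReal_congr hae, setIntegral_congr_set hae, cellDensity_toReal,
      integral_toReal hf.aemeasurable (ae_restrict_of_ae hlt),
      ← withDensity_apply _ (measurableSet_cell n _), ← hac, smul_eq_mul]
    congr 1
    exact (eq_inv_of_mul_eq_one_left hvol).symm

end CellDensity

theorem integral_sub_sub_add {α : Type*} [MeasurableSpace α] {μ : Measure α} {u v w z : α → ℝ}
    (hu : Integrable u μ) (hv : Integrable v μ) (hw : Integrable w μ) (hz : Integrable z μ) :
    ∫ x, (u x - v x - w x + z x) ∂μ =
      (∫ x, u x ∂μ) - (∫ x, v x ∂μ) - (∫ x, w x ∂μ) + ∫ x, z x ∂μ := by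
  rw [← integral_sub hu hv, ← integral_sub (f := fun x => u x - v x) (hu.sub hv) hw,
    ← integral_add (f := fun x => u x - v x - w x) ((hu.sub hv).sub hw) hz]

/-- The averaged log-densities converge to `∫ f log f`: the upper bound is Gibbs' inequality and
the lower bound is Fatou's lemma for the relative entropy densities with respect to the
averages over unit cells. -/
theorem tendsto_integral_log_cellDensity {N : ℕ} (ν : Measure (Fin N → ℝ)) [IsProbabilityMeasure ν]
    {f : (Fin N → ℝ) → ℝ≥0∞} (hf : Measurable f) (hac : ν = volume.withDensity f)
    (h1 : Integrable (fun x => Real.log (cellDensity ν 1 x).toReal) ν)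
    (hint : Integrable (fun x => (f x).toReal * Real.log (f x).toReal) volume) :
    Tendsto (fun n => ∫ x, Real.log (cellDensity ν n x).toReal ∂ν) atTop
      (nhds (∫ x, (f x).toReal * Real.log (f x).toReal)) := by
  set F : (Fin N → ℝ) → ℝ := fun x => (f x).toReal with hF_def
  set a : ℕ → (Fin N → ℝ) → ℝ := fun n x => (cellDensity ν n x).toReal with ha_def
  have hfin : ∫⁻ x, f x ≠ ∞ := by
    rw [← setLIntegral_univ, ← withDensity_apply _ MeasurableSet.univ, ← hac]
    exact measure_ne_top _ _
  have hlt : ∀ᵐ x, f x < ∞ := ae_lt_top hf hfin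
  have hF : Integrable F volume := integrable_toReal_of_lintegral_ne_top hf.aemeasurable hfin
  have hF1 : ∫ x, F x = 1 := by
    rw [integral_toReal hf.aemeasurable hlt, ← setLIntegral_univ,
      ← withDensity_apply _ MeasurableSet.univ, ← hac, measure_univ, ENNReal.toReal_one]
  have hFnn : ∀ x, 0 ≤ F x := fun x => ENNReal.toReal_nonneg
  have hann : ∀ n x, 0 ≤ a n x := fun n x => ENNReal.toReal_nonneg
  have hameas : ∀ n, Measurable (a n) := fun n => (measurable_cellDensity ν n).ennreal_toReal
  have hlog : ∀ n, 0 < n → Integrable (fun x => Real.log (a n x)) ν := fun n hn =>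
    integrable_log_cellDensity ν hn h1
  have haint : ∀ n, 0 < n → Integrable (a n) volume := fun n hn => integrable_cellDensity ν hn
  have ha1 : ∀ n, 0 < n → ∫ x, a n x = 1 := fun n hn => integral_cellDensity ν hn
  have hFlog : ∀ n, 0 < n → Integrable (fun x => F x * Real.log (a n x)) volume := by
    intro n hn
    have := integrable_withDensity_iff_integrable_smul' hf hlt (g := fun x => Real.log (a n x))
    rw [← hac] at this
    exact this.1 (hlog n hn)
  have hFlog_eq : ∀ n, ∫ x, Real.log (a n x) ∂ν = ∫ x, F x * Real.log (a n x) := by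
    intro n
    have := integral_withDensity_eq_integral_toReal_smul hf hlt (fun x => Real.log (a n x))
    rw [← hac] at this
    exact this
  have hFzero : ∀ n, 0 < n → ∀ᵐ x, a n x = 0 → F x = 0 := by
    intro n hn
    have := ae_cellDensity_toReal_pos ν hn
    rw [hac, ae_withDensity_iff hf, ← hac] at this
    filter_upwards [this] with x hx h0
    by_contra hne
    exact (hx fun h => hne (by simp [hF_def, h])).ne' h0
  have hupper : ∀ n, 0 < n → ∫ x, Real.log (a n x) ∂ν ≤ ∫ x, F x * Real.log (F x) := by
    intro n hn
    have hle : ∫ x, F x * Real.log (a n x) ≤ ∫ x, (F x * Real.log (F x) - F x + a n x) := by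
      refine integral_mono_ae (hFlog n hn) ((hint.sub hF).add (haint n hn)) ?_
      filter_upwards [hFzero n hn] with x hx
      exact mul_log_le_mul_log_sub_add (hFnn x) (hann n x) hx
    rw [integral_add (f := fun x => F x * Real.log (F x) - F x) (hint.sub hF) (haint n hn),
      integral_sub hint hF, hF1, ha1 n hn] at hle
    rw [hFlog_eq]
    linarith
  set G : ℕ → (Fin N → ℝ) → ℝ :=
    fun n x => a n x * Real.log (a n x) - a n x * Real.log (a 1 x) - a n x + a 1 x with hG_def
  set G' : (Fin N → ℝ) → ℝ :=
    fun x => F x * Real.log (F x) - F x * Real.log (a 1 x) - F x + a 1 x with hG'_def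
  have hGmeas : ∀ n, Measurable (G n) := fun n =>
    ((((hameas n).mul (hameas n).log).sub ((hameas n).mul (hameas 1).log)).sub (hameas n)).add
      (hameas 1)
  have hGnn : ∀ n, 0 < n → ∀ x, 0 ≤ G n x := by
    intro n hn x
    have := mul_log_le_mul_log_sub_add (hann n x) (hann 1 x)
      (cellDensity_toReal_eq_zero_of_one ν hn x)
    simp only [hG_def]
    linarith
  have hG'nn : ∀ᵐ x, 0 ≤ G' x := by
    filter_upwards [hFzero 1 one_pos] with x hx
    have := mul_log_le_mul_log_sub_add (hFnn x) (hann 1 x) hx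
    simp only [hG'_def]
    linarith
  have hG'int : Integrable G' volume :=
    ((hint.sub (hFlog 1 one_pos)).sub hF).add (haint 1 one_pos)
  have hG'_eq : ∫ x, G' x = (∫ x, F x * Real.log (F x)) - ∫ x, Real.log (a 1 x) ∂ν := by
    rw [hG'_def, integral_sub_sub_add hint (hFlog 1 one_pos) hF (haint 1 one_pos), hF1,
      ha1 1 one_pos, hFlog_eq 1]
    ring
  have hcomp1 : ∀ n : ℕ, 0 < n → ∀ x, Real.log (a 1 x) =
      (fun k : Fin N → ℤ => Real.log (ν.real (quantIndex 1 ⁻¹' {fun i => k i / (n : ℤ)})))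
        (quantIndex n x) := fun n hn x => by
    simp only [ha_def]
    rw [cellDensity_one_eq_comp ν hn]
  have hint1 : ∀ n, 0 < n → Integrable (fun x => a n x * Real.log (a n x)) volume := by
    intro n hn
    have := hlog n hn
    simp only [ha_def, log_cellDensity_eq_comp] at this ⊢
    exact (integrable_comp_quantIndex_iff ν hn
      fun k => Real.log ((n : ℝ) ^ N * ν.real (quantIndex n ⁻¹' {k}))).1 this
  have heq1 : ∀ n, 0 < n → ∫ x, a n x * Real.log (a n x) = ∫ x, Real.log (a n x) ∂ν := by
    intro n hn
    simp only [ha_def, log_cellDensity_eq_comp]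
    exact (integral_comp_quantIndex ν hn
      fun k => Real.log ((n : ℝ) ^ N * ν.real (quantIndex n ⁻¹' {k}))).symm
  have hint2 : ∀ n, 0 < n → Integrable (fun x => a n x * Real.log (a 1 x)) volume := by
    intro n hn
    have := hlog 1 one_pos
    simp only [hcomp1 n hn] at this ⊢
    exact (integrable_comp_quantIndex_iff ν hn fun k =>
      Real.log (ν.real (quantIndex 1 ⁻¹' {fun i => k i / (n : ℤ)}))).1 this
  have heq2 : ∀ n, 0 < n → ∫ x, a n x * Real.log (a 1 x) = ∫ x, Real.log (a 1 x) ∂ν := by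
    intro n hn
    simp only [hcomp1 n hn]
    exact (integral_comp_quantIndex ν hn fun k =>
      Real.log (ν.real (quantIndex 1 ⁻¹' {fun i => k i / (n : ℤ)}))).symm
  have hGint : ∀ n, 0 < n → Integrable (G n) volume := fun n hn =>
    (((hint1 n hn).sub (hint2 n hn)).sub (haint n hn)).add
      (haint 1 one_pos)
  have hG_eq : ∀ n, 0 < n →
      ∫ x, G n x = (∫ x, Real.log (a n x) ∂ν) - ∫ x, Real.log (a 1 x) ∂ν := by
    intro n hn
    rw [hG_def, integral_sub_sub_add (hint1 n hn) (hint2 n hn) (haint n hn) (haint 1 one_pos),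
      heq1 n hn, heq2 n hn, ha1 n hn, ha1 1 one_pos]
    ring
  have hGtendsto : ∀ᵐ x, Tendsto (fun n => G n x) atTop (nhds (G' x)) := by
    filter_upwards [ae_tendsto_cellDensity ν hf hac] with x hx
    exact ((((Real.continuous_mul_log.tendsto _).comp hx).sub (hx.mul_const _)).sub hx).add_const _
  have hfatou : ENNReal.ofReal (∫ x, G' x) ≤
      liminf (fun n => ∫⁻ x, ENNReal.ofReal (G n x)) atTop := by
    rw [ofReal_integral_eq_lintegral_ofReal hG'int hG'nn]
    refine le_of_eq_of_le (lintegral_congr_ae ?_)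
      (lintegral_liminf_le fun n => (hGmeas n).ennreal_ofReal)
    filter_upwards [hGtendsto] with x hx
    exact ((ENNReal.continuous_ofReal.tendsto _).comp hx).liminf_eq.symm
  have hlim : Tendsto (fun n => ∫⁻ x, ENNReal.ofReal (G n x)) atTop
      (nhds (ENNReal.ofReal (∫ x, G' x))) := by
    refine tendsto_of_le_liminf_of_limsup_le hfatou (limsup_le_of_le (by isBoundedDefault) ?_)
    filter_upwards [eventually_gt_atTop 0] with n hn
    rw [← ofReal_integral_eq_lintegral_ofReal (hGint n hn) (ae_of_all _ (hGnn n hn))]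
    refine ENNReal.ofReal_le_ofReal ?_
    rw [hG_eq n hn, hG'_eq]
    linarith [hupper n hn]
  have hlim' := (ENNReal.tendsto_toReal ENNReal.ofReal_ne_top).comp hlim
  rw [ENNReal.toReal_ofReal (integral_nonneg_of_ae hG'nn), hG'_eq] at hlim'
  have hfinal := hlim'.add_const (∫ x, Real.log (a 1 x) ∂ν)
  rw [sub_add_cancel] at hfinal
  refine hfinal.congr' ?_
  filter_upwards [eventually_gt_atTop 0] with n hn
  rw [Function.comp_apply,
    ← ofReal_integral_eq_lintegral_ofReal (hGint n hn) (ae_of_all _ (hGnn n hn)),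
    ENNReal.toReal_ofReal (integral_nonneg (hGnn n hn)), hG_eq n hn, sub_add_cancel]

/-- (Rényi's theorem on quantized entropies.)  Let `X` be an
`N`-dimensional random variable whose distribution `ν` is absolutely continuous
w.r.t. Lebesgue measure, with density `f`, finite differential entropy
`h = −∫ f log f` and `H(X̂₁) < ∞`.  Then `H(X̂_n) = N log n + h + o(1)` as `n → ∞`;
in particular the information dimension `d(X) = lim_n H(X̂_n)/log n` equals `N`. -/
theorem renyi_quantized_entropy_asymptotics
    {N : ℕ} (hN : 0 < N)
    (ν : Measure (Fin N → ℝ)) [IsProbabilityMeasure ν]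
    (f : (Fin N → ℝ) → ℝ≥0∞) (hf : Measurable f)
    (hac : ν = volume.withDensity f)
    (hH1 : Summable (fun k : Fin N → ℤ =>
      Real.negMulLog (ν {x | ∀ i, ⌊(1 : ℝ) * x i⌋ = k i}).toReal))
    (hint : Integrable (fun x => (f x).toReal * Real.log (f x).toReal) volume)
    (h : ℝ) (hdiff : h = - ∫ x, (f x).toReal * Real.log (f x).toReal) :
    Tendsto (fun n => quantEntropy ν n - (N : ℝ) * Real.log n) atTop (nhds h) ∧
    Tendsto (fun n => quantEntropy ν n / Real.log n) atTop (nhds (N : ℝ)) := by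
  have h1 := integrable_log_cellDensity_one ν hH1
  have hmain : Tendsto (fun n => quantEntropy ν n - (N : ℝ) * Real.log n) atTop (nhds h) := by
    rw [hdiff]
    refine (tendsto_integral_log_cellDensity ν hf hac h1 hint).neg.congr' ?_
    filter_upwards [eventually_gt_atTop 0] with n hn
    exact (quantEntropy_sub_eq ν hn (integrable_log_cellDensity ν hn h1)).symm
  refine ⟨hmain, ?_⟩
  have hlog : Tendsto (fun n : ℕ => Real.log n) atTop atTop :=
    Real.tendsto_log_atTop.comp tendsto_natCast_atTop_atTop
  have hquot := (hmain.div_atTop hlog).add_const (N : ℝ)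
  rw [zero_add] at hquot
  refine hquot.congr' ?_
  filter_upwards [hlog.eventually_gt_atTop 0] with n hn
  rw [sub_div, mul_div_cancel_right₀ _ hn.ne', sub_add_cancel]
end
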